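/- arXiv:1910.12393 — 6 statements merged into one kernel-verified Lean document; each statement's English description precedes it below -/
import Mathlib

section
/- Let n ≥ 1, let a, b ∈ ℝⁿ with a ≤ b componentwise, and let L = {x ∈ ℝⁿ : a ≤ x ≤ b componentwise}. Let G : ℝⁿ → ℝ be differentiable, and suppose K₁ ≥ 0 is such that the function x ↦ K₁‖x‖² − G(x) is convex on L (i.e. ∇²G(x) ⪯ 2K₁ I on L). Let x* ∈ L be a local minimizer of G over L, and let x ∈ L be a point whose set of active bound constraints contains that of x*, i.e. for every coordinate i, x*ᵢ = aᵢ implies xᵢ = aᵢ and x*ᵢ = bᵢ implies xᵢ = bᵢ. Then G(x) − G(x*) ≤ K₁‖x − x*‖². -/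
open Filter Topology

/-- If `K‖·‖² - G` is convex on `L` and the segment from `x` to a local minimizer `y` of `G` on `L`
can be prolonged beyond `y` inside `L`, then `G` grows at most quadratically from `y` to `x`. -/
theorem IsLocalMinOn.sub_le_mul_norm_sub_sq {E : Type*} [NormedAddCommGroup E]
    [InnerProductSpace ℝ E] {L : Set E} {G : E → ℝ} {K : ℝ} {x y : E}
    (hmin : IsLocalMinOn G L y)
    (hconv : ConvexOn ℝ L (fun z => K * ‖z‖ ^ 2 - G z)) (hx : x ∈ L)
    (hmem : ∀ᶠ t : ℝ in 𝓝[>] 0, y - t • (x - y) ∈ L) :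
    G x - G y ≤ K * ‖x - y‖ ^ 2 := by
  have hto : Tendsto (fun t : ℝ => y - t • (x - y)) (𝓝[>] 0) (𝓝[L] y) := by
    refine tendsto_nhdsWithin_iff.2 ⟨?_, hmem⟩
    have hcont : Continuous fun t : ℝ => y - t • (x - y) := by fun_prop
    simpa using (hcont.tendsto 0).mono_left nhdsWithin_le_nhds
  have hlim : Tendsto (fun t : ℝ => K * ‖x - y‖ ^ 2 * (1 + t)) (𝓝[>] 0)
      (𝓝 (K * ‖x - y‖ ^ 2)) := by
    have hcont : Continuous fun t : ℝ => K * ‖x - y‖ ^ 2 * (1 + t) := by fun_prop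
    simpa using (hcont.tendsto 0).mono_left nhdsWithin_le_nhds
  refine ge_of_tendsto hlim ?_
  filter_upwards [hmem, hto.eventually hmin, self_mem_nhdsWithin] with t htL htG ht
  have ht : 0 < t := ht
  have hpos : 0 < 1 + t := by positivity
  have ha : 0 ≤ t / (1 + t) := by positivity
  have hb : 0 ≤ 1 / (1 + t) := by positivity
  have hc := hconv.2 hx htL ha hb (by field_simp; ring)
  have hy : (t / (1 + t)) • x + (1 / (1 + t)) • (y - t • (x - y)) = y := by
    match_scalars <;> field_simp <;> ring
  simp only [hy, smul_eq_mul] at hc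
  have hc' : (1 + t) * (K * ‖y‖ ^ 2 - G y) ≤
      t * (K * ‖x‖ ^ 2 - G x) + (K * ‖y - t • (x - y)‖ ^ 2 - G (y - t • (x - y))) := by
    calc _ ≤ (1 + t) * _ := mul_le_mul_of_nonneg_left hc hpos.le
      _ = _ := by field_simp
  have hnorm : t * ‖x‖ ^ 2 + ‖y - t • (x - y)‖ ^ 2 =
      (1 + t) * ‖y‖ ^ 2 + t * (1 + t) * ‖x - y‖ ^ 2 := by
    simp only [← real_inner_self_eq_norm_sq, inner_sub_left, inner_sub_right, inner_smul_left,
      inner_smul_right, real_inner_comm x y, RCLike.conj_to_real]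
    ring
  have hK := congrArg (K * ·) hnorm
  refine le_of_mul_le_mul_left ?_ ht
  linarith

/-- If `y ≤ c` and `x = c` whenever `y = c`, then moving slightly from
`y` away from `x` does not violate the bound. -/
theorem eventually_sub_mul_sub_le {c x y : ℝ} (hy : y ≤ c) (h : y = c → x = c) :
    ∀ᶠ t : ℝ in 𝓝[>] 0, y - t * (x - y) ≤ c := by
  rcases hy.eq_or_lt with rfl | hlt
  · simp [h rfl]
  · have hcont : Continuous fun t : ℝ => y - t * (x - y) := by fun_prop
    have h0 := (hcont.tendsto 0).mono_left (nhdsWithin_le_nhds (s := Set.Ioi 0))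
    exact h0.eventually_le_const (by simpa using hlt)

/-- Lemma 3 of the paper: if `∇²G ⪯ 2K₁ I` on the box `L` (encoded by convexity of
`x ↦ K₁‖x‖² − G x` on `L`), `x*` is a local minimizer of `G` over `L`, and the active
bound constraints of `x*` are also active at `x ∈ L`, then
`G x − G x* ≤ K₁ ‖x − x*‖²`. -/
theorem stmt_1 (n : ℕ) (hn : 1 ≤ n)
    (a b : EuclideanSpace ℝ (Fin n)) (hab : ∀ i, a i ≤ b i)
    (L : Set (EuclideanSpace ℝ (Fin n)))
    (hL : L = {x | ∀ i, a i ≤ x i ∧ x i ≤ b i})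
    (G : EuclideanSpace ℝ (Fin n) → ℝ) (hG : Differentiable ℝ G)
    (K₁ : ℝ) (hK₁ : 0 ≤ K₁)
    (hconv : ConvexOn ℝ L (fun x => K₁ * ‖x‖ ^ 2 - G x))
    (xs : EuclideanSpace ℝ (Fin n)) (hxs : xs ∈ L)
    (hmin : IsLocalMinOn G L xs)
    (x : EuclideanSpace ℝ (Fin n)) (hx : x ∈ L)
    (hactive : ∀ i, (xs i = a i → x i = a i) ∧ (xs i = b i → x i = b i)) :
    G x - G xs ≤ K₁ * ‖x - xs‖ ^ 2 := by
  subst hL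
  refine hmin.sub_le_mul_norm_sub_sq hconv hx ?_
  simp only [Set.mem_ofPred_eq, eventually_all, eventually_and, PiLp.sub_apply, PiLp.smul_apply,
    smul_eq_mul]
  refine fun i => ⟨?_, eventually_sub_mul_sub_le (hxs i).2 (hactive i).2⟩
  have h := eventually_sub_mul_sub_le (c := -a i) (x := -x i) (y := -xs i)
    (neg_le_neg (hxs i).1) (fun h => congrArg Neg.neg ((hactive i).1 (neg_injective h)))
  filter_upwards [h] with t ht
  linarith
end

section
/- Let E be a Euclidean space (ℝᵈ with the Euclidean norm), let V be a finite set of points in E, and suppose Z_j ∈ E and R_j ≥ 0 satisfy ‖v − Z_j‖ = R_j for every v ∈ V (V lies on the sphere of center Z_j and radius R_j), while Z_i ∈ E and R_i ≥ 0 satisfy ‖v − Z_i‖ ≥ R_i for every v ∈ V (the ball of center Z_i and radius R_i contains no point of V in its interior boundary sense). Then for every x in the convex hull of V, R_i² − ‖x − Z_i‖² ≤ R_j² − ‖x − Z_j‖². -/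
/-- The difference of the squared distances to two points is affine, so its sublevel sets are
convex. -/
theorem convex_setOf_norm_sub_sq_sub_norm_sub_sq_le {E : Type*} [NormedAddCommGroup E]
    [InnerProductSpace ℝ E] (a b : E) (c : ℝ) :
    Convex ℝ {x : E | ‖x - a‖ ^ 2 - ‖x - b‖ ^ 2 ≤ c} := by
  have h : {x : E | ‖x - a‖ ^ 2 - ‖x - b‖ ^ 2 ≤ c} =
      {x : E | innerSL ℝ (b - a) x ≤ (c - ‖a‖ ^ 2 + ‖b‖ ^ 2) / 2} := by
    ext x
    simp only [Set.mem_ofPred_eq, innerSL_apply_apply, norm_sub_sq_real, inner_sub_left,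
      real_inner_comm x]
    constructor <;> intro h <;> linarith
  rw [h]
  exact convex_halfSpace_le (innerSL ℝ (b - a)).isLinear _

/-- Delaunay empty-circumsphere comparison: if every point of `V` lies on the sphere of
center `Z_j`, radius `R_j`, and every point of `V` lies on or outside the sphere of
center `Z_i`, radius `R_i`, then on the convex hull of `V` the local remoteness function
of the `i`-sphere is dominated by that of the `j`-sphere. -/
theorem stmt_3 (d : ℕ) (V : Finset (EuclideanSpace ℝ (Fin d)))
    (Zj : EuclideanSpace ℝ (Fin d)) (Rj : ℝ) (hRj : 0 ≤ Rj)
    (hj : ∀ v ∈ V, ‖v - Zj‖ = Rj)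
    (Zi : EuclideanSpace ℝ (Fin d)) (Ri : ℝ) (hRi : 0 ≤ Ri)
    (hi : ∀ v ∈ V, Ri ≤ ‖v - Zi‖) :
    ∀ x ∈ convexHull ℝ (V : Set (EuclideanSpace ℝ (Fin d))),
      Ri ^ 2 - ‖x - Zi‖ ^ 2 ≤ Rj ^ 2 - ‖x - Zj‖ ^ 2 := by
  intro x hx
  have hsub : (V : Set (EuclideanSpace ℝ (Fin d))) ⊆
      {y | ‖y - Zj‖ ^ 2 - ‖y - Zi‖ ^ 2 ≤ Rj ^ 2 - Ri ^ 2} := by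
    intro v hv
    have hsq : Ri ^ 2 ≤ ‖v - Zi‖ ^ 2 := pow_le_pow_left₀ hRi (hi v hv) 2
    simp only [Set.mem_ofPred_eq, hj v hv]
    linarith
  have hmem : ‖x - Zj‖ ^ 2 - ‖x - Zi‖ ^ 2 ≤ Rj ^ 2 - Ri ^ 2 :=
    convexHull_min hsub (convex_setOf_norm_sub_sq_sub_norm_sub_sq_le Zj Zi _) hx
  linarith
end

section
/- Let E be a Euclidean space (ℝᵈ with the Euclidean norm) and let V be a finite set of points in E. Suppose Z_i, Z_j ∈ E and R_i, R_j ≥ 0 satisfy ‖v − Z_i‖ = R_i and ‖v − Z_j‖ = R_j for every v ∈ V (V lies on both spheres). Then for every x in the convex hull of V, R_i² − ‖x − Z_i‖² = R_j² − ‖x − Z_j‖². -/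
/-- The locus where two power functions (with arbitrary centers and constants) agree is convex. -/
theorem convex_setOf_sub_norm_sub_sq_eq {E : Type*} [NormedAddCommGroup E]
    [InnerProductSpace ℝ E] (p q : E) (a b : ℝ) :
    Convex ℝ {x : E | a - ‖x - p‖ ^ 2 = b - ‖x - q‖ ^ 2} := by
  intro x hx y hy s t _ _ hst
  simp only [Set.mem_ofPred_eq, norm_sub_sq_real, inner_add_left, real_inner_smul_left] at hx hy ⊢
  linear_combination s * hx + t * hy + (b - a + ‖p‖ ^ 2 - ‖q‖ ^ 2) * hst

/-- Consistency of the piecewise remoteness function across shared faces: if every point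
of `V` lies on both spheres (center `Z_i`, radius `R_i` and center `Z_j`, radius `R_j`),
then the two local remoteness functions agree on the convex hull of `V`. -/
theorem stmt_4 (d : ℕ) (V : Finset (EuclideanSpace ℝ (Fin d)))
    (Zi Zj : EuclideanSpace ℝ (Fin d)) (Ri Rj : ℝ) (hRi : 0 ≤ Ri) (hRj : 0 ≤ Rj)
    (hi : ∀ v ∈ V, ‖v - Zi‖ = Ri) (hj : ∀ v ∈ V, ‖v - Zj‖ = Rj) :
    ∀ x ∈ convexHull ℝ (V : Set (EuclideanSpace ℝ (Fin d))),
      Ri ^ 2 - ‖x - Zi‖ ^ 2 = Rj ^ 2 - ‖x - Zj‖ ^ 2 := by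
  refine convexHull_min (fun v hv => ?_) (convex_setOf_sub_norm_sub_sq_eq Zi Zj (Ri ^ 2) (Rj ^ 2))
  show Ri ^ 2 - ‖v - Zi‖ ^ 2 = Rj ^ 2 - ‖v - Zj‖ ^ 2
  rw [hi v hv, hj v hv, sub_self, sub_self]
end

section
/- Let E be a Euclidean space (ℝᵈ with the Euclidean norm), let v₀, …, v_m be finitely many points of E, and let Z ∈ E, R ≥ 0 satisfy ‖v_k − Z‖ = R for every k. Let K̂ ≥ 0 and let p, f : E → ℝ be functions such that x ↦ p(x) + K̂‖x‖² is convex and x ↦ K̂‖x‖² − f(x) is convex (i.e. ∇²p ⪰ −2K̂ I and ∇²f ⪯ 2K̂ I). Then for every K ≥ 3K̂ and every x in the convex hull of {v₀, …, v_m}: p(x) − 2f(x) − K·(R² − ‖x − Z‖²) ≤ max over k of (p(v_k) − 2f(v_k)). -/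
theorem convexOn_sub_two_mul_add_mul_norm_sub_sq {E : Type*} [NormedAddCommGroup E]
    [InnerProductSpace ℝ E] {p f : E → ℝ} {L K : ℝ} {s : Set E}
    (hp : ConvexOn ℝ s (fun x => p x + L * ‖x‖ ^ 2))
    (hf : ConvexOn ℝ s (fun x => L * ‖x‖ ^ 2 - f x)) (hK : 3 * L ≤ K) (z : E) :
    ConvexOn ℝ s (fun x => p x - 2 * f x + K * ‖x - z‖ ^ 2) := by
  have hs : Convex ℝ s := hp.1
  have hnorm : ConvexOn ℝ s (fun x : E => ‖x‖ ^ 2) :=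
    (convexOn_norm hs).pow (fun x _ => norm_nonneg x) 2
  have hinner : ConvexOn ℝ s (fun x : E => inner ℝ ((-2 * K) • z) x) :=
    (innerSL ℝ ((-2 * K) • z)).toLinearMap.convexOn hs
  have hsum := (((hp.add (hf.smul zero_le_two)).add
    (hnorm.smul (sub_nonneg.2 hK))).add hinner).add_const (K * ‖z‖ ^ 2)
  refine hsum.congr fun x _ => ?_
  simp only [Pi.add_apply, smul_eq_mul, real_inner_smul_left, norm_sub_sq_real,
    real_inner_comm x z]
  ring

/-- Core estimate in the proof of Lemma 4 of the paper: with `‖v k − Z‖ = R` for all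
vertices, `∇²p ⪰ −2Khat I` and `∇²f ⪯ 2Khat I` (encoded by convexity of `p + Khat‖·‖²` and of
`Khat‖·‖² − f`), for every `K ≥ 3Khat` and every `x` in the convex hull of the vertices,
`p x − 2 f x − K (R² − ‖x − Z‖²)` is bounded by the maximum of `p (v k) − 2 f (v k)`. -/
theorem stmt_5 (d m : ℕ) (v : Fin (m + 1) → EuclideanSpace ℝ (Fin d))
    (Z : EuclideanSpace ℝ (Fin d)) (R : ℝ) (hR : 0 ≤ R)
    (hv : ∀ k, ‖v k - Z‖ = R)
    (Khat : ℝ) (hKhat : 0 ≤ Khat)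
    (p f : EuclideanSpace ℝ (Fin d) → ℝ)
    (hp : ConvexOn ℝ Set.univ (fun x => p x + Khat * ‖x‖ ^ 2))
    (hf : ConvexOn ℝ Set.univ (fun x => Khat * ‖x‖ ^ 2 - f x)) :
    ∀ K : ℝ, 3 * Khat ≤ K →
      ∀ x ∈ convexHull ℝ (Set.range v),
        p x - 2 * f x - K * (R ^ 2 - ‖x - Z‖ ^ 2) ≤
          Finset.univ.sup' Finset.univ_nonempty (fun k => p (v k) - 2 * f (v k)) := by
  intro K hK x hx
  obtain ⟨_, ⟨k, rfl⟩, hk⟩ :=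
    ((convexOn_sub_two_mul_add_mul_norm_sub_sq hp hf hK Z).subset (Set.subset_univ _)
      (convex_convexHull ℝ _)).exists_ge_of_mem_convexHull (subset_convexHull ℝ _) hx
  rw [hv k] at hk
  calc p x - 2 * f x - K * (R ^ 2 - ‖x - Z‖ ^ 2)
      ≤ p (v k) - 2 * f (v k) := by linarith
    _ ≤ _ := Finset.le_sup' (fun k => p (v k) - 2 * f (v k)) (Finset.mem_univ k)
end

section
/- Let n ≥ 1 and a, b ∈ ℝⁿ with a ≤ b componentwise, let N ≥ 1 be an integer, and let G(N) = { g ∈ ℝⁿ : for every j there exists z_j ∈ {0, 1, …, N} with g_j = a_j + (b_j − a_j)·z_j/N } be the Cartesian grid of size N over the box L = {x ∈ ℝⁿ : a ≤ x ≤ b componentwise}. Then the supremum over x ∈ L of the Euclidean distance from x to the nearest grid point equals ‖b − a‖/(2N); in particular, for every x ∈ L there exists g ∈ G(N) with ‖x − g‖ ≤ ‖b − a‖/(2N), and there exists a point x ∈ L whose distance to every grid point is at least ‖b − a‖/(2N). -/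
/-- The Euclidean norm is monotone in the absolute values of the coordinates. -/
theorem EuclideanSpace.norm_le_norm_of_abs_le {ι : Type*} [Fintype ι]
    {x y : EuclideanSpace ℝ ι} (h : ∀ i, |x i| ≤ |y i|) : ‖x‖ ≤ ‖y‖ := by
  rw [EuclideanSpace.norm_eq, EuclideanSpace.norm_eq]
  refine Real.sqrt_le_sqrt (Finset.sum_le_sum fun i _ => ?_)
  simpa only [Real.norm_eq_abs] using pow_le_pow_left₀ (abs_nonneg _) (h i) 2

/-- Every point of `[a, b]` is within half a step of the uniform grid with `N` steps. -/
theorem exists_grid_abs_sub_le {a b x : ℝ} (hax : a ≤ x) (hxb : x ≤ b) {N : ℕ} (hN : 1 ≤ N) :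
    ∃ z : ℕ, z ≤ N ∧ |x - (a + (b - a) * z / N)| ≤ (b - a) / (2 * N) := by
  have hN0 : (0 : ℝ) < N := by exact_mod_cast hN
  rcases (hax.trans hxb).eq_or_lt with rfl | hab
  · exact ⟨0, Nat.zero_le _, by simp [le_antisymm hxb hax]⟩
  have hd : 0 < b - a := sub_pos.2 hab
  set t : ℝ := (x - a) / (b - a) * N with ht
  have ht0 : 0 ≤ t := by have := sub_nonneg.2 hax; positivity
  have htN : t ≤ N :=
    mul_le_of_le_one_left hN0.le ((div_le_one hd).2 (by linarith))
  have hlo : (⌊t + 1 / 2⌋₊ : ℝ) ≤ t + 1 / 2 := Nat.floor_le (by positivity)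
  have hhi : t + 1 / 2 < ⌊t + 1 / 2⌋₊ + 1 := Nat.lt_floor_add_one _
  refine ⟨⌊t + 1 / 2⌋₊, ?_, ?_⟩
  · have : (⌊t + 1 / 2⌋₊ : ℝ) < (N + 1 : ℕ) := by push_cast; linarith
    exact Nat.lt_succ_iff.1 (by exact_mod_cast this)
  · have hx : x - (a + (b - a) * (⌊t + 1 / 2⌋₊ : ℝ) / N) =
        (b - a) / N * (t - ⌊t + 1 / 2⌋₊) := by
      rw [mul_sub, ht]
      field_simp
      ring
    have habs : |t - ⌊t + 1 / 2⌋₊| ≤ 1 / 2 := abs_le.2 ⟨by linarith, by linarith⟩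
    rw [hx, abs_mul, abs_of_pos (by positivity)]
    calc (b - a) / N * |t - ⌊t + 1 / 2⌋₊| ≤ (b - a) / N * (1 / 2) := by gcongr
      _ = (b - a) / (2 * N) := by field_simp

/-- The midpoint of the first cell is at least half a step away from every grid point. -/
theorem le_abs_midpoint_sub_grid {a b : ℝ} (hab : a ≤ b) {N : ℕ} (hN : 1 ≤ N) (z : ℕ) :
    (b - a) / (2 * N) ≤ |a + (b - a) / (2 * N) - (a + (b - a) * z / N)| := by
  have hN0 : (0 : ℝ) < N := by exact_mod_cast hN
  have hc : 0 ≤ (b - a) / (2 * N) := div_nonneg (sub_nonneg.2 hab) (by positivity)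
  have hx : a + (b - a) / (2 * N) - (a + (b - a) * z / N) =
      (b - a) / (2 * N) * (1 - 2 * z) := by
    field_simp
    ring
  have hz : (1 : ℝ) ≤ |1 - 2 * (z : ℝ)| := by
    have : (1 : ℤ) ≤ |1 - 2 * (z : ℤ)| := Int.one_le_abs (by omega)
    exact_mod_cast this
  rw [hx, abs_mul, abs_of_nonneg hc]
  exact le_mul_of_one_le_right hc hz

/-- Maximum quantization error of the Cartesian grid of size `N` over the box
`L = {x | a ≤ x ≤ b}` (Definition 2 / eq. (6) of the paper): the supremum over `x ∈ L`
of the distance to the nearest grid point equals `‖b − a‖ / (2N)`; in particular every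
`x ∈ L` is within `‖b − a‖/(2N)` of some grid point, and some `x ∈ L` is at distance at
least `‖b − a‖/(2N)` from every grid point. -/
theorem stmt_6 (n : ℕ) (hn : 1 ≤ n)
    (a b : EuclideanSpace ℝ (Fin n)) (hab : ∀ j, a j ≤ b j)
    (N : ℕ) (hN : 1 ≤ N)
    (L : Set (EuclideanSpace ℝ (Fin n)))
    (hL : L = {x | ∀ j, a j ≤ x j ∧ x j ≤ b j})
    (G : Set (EuclideanSpace ℝ (Fin n)))
    (hG : G = {g | ∀ j, ∃ z : ℕ, z ≤ N ∧ g j = a j + (b j - a j) * z / N}) :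
    sSup ((fun x => Metric.infDist x G) '' L) = ‖b - a‖ / (2 * N) ∧
    (∀ x ∈ L, ∃ g ∈ G, ‖x - g‖ ≤ ‖b - a‖ / (2 * N)) ∧
    (∃ x ∈ L, ∀ g ∈ G, ‖b - a‖ / (2 * N) ≤ ‖x - g‖) := by
  have hN0 : (0 : ℝ) < N := by exact_mod_cast hN
  have hN1 : (1 : ℝ) ≤ N := by exact_mod_cast hN
  have hnorm : ‖b - a‖ / (2 * N) = ‖(2 * N : ℝ)⁻¹ • (b - a)‖ := by
    rw [norm_smul, Real.norm_of_nonneg (by positivity), div_eq_inv_mul]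
  have hcoord (j : Fin n) : |((2 * N : ℝ)⁻¹ • (b - a)) j| = (b j - a j) / (2 * N) := by
    rw [PiLp.smul_apply, PiLp.sub_apply, smul_eq_mul, ← div_eq_inv_mul,
      abs_of_nonneg (div_nonneg (sub_nonneg.2 (hab j)) (by positivity))]
  have upper : ∀ x ∈ L, ∃ g ∈ G, ‖x - g‖ ≤ ‖b - a‖ / (2 * N) := by
    subst hL hG
    intro x hx
    choose z hz hxz using fun j => exists_grid_abs_sub_le (hx j).1 (hx j).2 hN
    refine ⟨WithLp.toLp 2 fun j => a j + (b j - a j) * z j / N,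
      fun j => ⟨z j, hz j, rfl⟩, ?_⟩
    rw [hnorm]
    refine EuclideanSpace.norm_le_norm_of_abs_le fun j => ?_
    rw [hcoord]
    exact hxz j
  have lower : ∃ x ∈ L, ∀ g ∈ G, ‖b - a‖ / (2 * N) ≤ ‖x - g‖ := by
    subst hL hG
    refine ⟨WithLp.toLp 2 fun j => a j + (b j - a j) / (2 * N), fun j => ?_, fun g hg => ?_⟩
    · have hd := sub_nonneg.2 (hab j)
      have h0 : 0 ≤ (b j - a j) / (2 * N) := by positivity
      have h1 : (b j - a j) / (2 * N) ≤ b j - a j := div_le_self hd (by linarith)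
      exact ⟨by simpa using h0, by simp only; linarith⟩
    · rw [hnorm]
      refine EuclideanSpace.norm_le_norm_of_abs_le fun j => ?_
      obtain ⟨z, -, hz⟩ := hg j
      rw [hcoord, PiLp.sub_apply, hz]
      exact le_abs_midpoint_sub_grid (hab j) hN z
  refine ⟨IsGreatest.csSup_eq ⟨?_, ?_⟩, upper, lower⟩
  · obtain ⟨x, hx, hxG⟩ := lower
    obtain ⟨g, hg, hxg⟩ := upper x hx
    refine ⟨x, hx, le_antisymm ?_ ?_⟩
    · exact (Metric.infDist_le_dist_of_mem hg).trans (by rwa [dist_eq_norm])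
    · exact (Metric.le_infDist ⟨g, hg⟩).2 fun y hy => by
        rw [dist_eq_norm]
        exact hxG y hy
  · rintro _ ⟨x, hx, rfl⟩
    obtain ⟨g, hg, hxg⟩ := upper x hx
    exact (Metric.infDist_le_dist_of_mem hg).trans (by rwa [dist_eq_norm])
end

section
/- Let n ≥ 1 and a, b ∈ ℝⁿ with a ≤ b componentwise, let N ≥ 1 be an integer, and let G(N) = { g ∈ ℝⁿ : for every j there exists z_j ∈ {0, 1, …, N} with g_j = a_j + (b_j − a_j)·z_j/N } be the Cartesian grid of size N over the box L = {x ∈ ℝⁿ : a ≤ x ≤ b componentwise}. Let x ∈ L and let g ∈ G(N) be a nearest grid point to x, i.e. ‖x − g‖ ≤ ‖x − g'‖ for all g' ∈ G(N). Then the active bound constraints of x are also active at g: for every coordinate j, x_j = a_j implies g_j = a_j, and x_j = b_j implies g_j = b_j. -/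
/-- If resetting the `j`-th coordinate of `g` to that of `x` does not bring `g` closer to `x`,
then the two coordinates already agree. -/
theorem EuclideanSpace.eq_of_norm_sub_le_norm_sub_update {ι : Type*} [Fintype ι] [DecidableEq ι]
    {x g : EuclideanSpace ℝ ι} {j : ι}
    (h : ‖x - g‖ ≤ ‖x - WithLp.toLp 2 (Function.update g j (x j))‖) : g j = x j := by
  have hsq := pow_le_pow_left₀ (norm_nonneg _) h 2
  rw [EuclideanSpace.real_norm_sq_eq, EuclideanSpace.real_norm_sq_eq,
    ← Finset.add_sum_erase _ _ (Finset.mem_univ j),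
    ← Finset.add_sum_erase _ _ (Finset.mem_univ j)] at hsq
  have hrest : ∑ i ∈ Finset.univ.erase j,
        ((x - WithLp.toLp 2 (Function.update g j (x j))) i) ^ 2 =
      ∑ i ∈ Finset.univ.erase j, ((x - g) i) ^ 2 :=
    Finset.sum_congr rfl fun i hi => by simp [Function.update_of_ne (Finset.ne_of_mem_erase hi)]
  rw [hrest] at hsq
  simp only [PiLp.sub_apply, Function.update_self, sub_self] at hsq
  nlinarith [sq_nonneg (x j - g j)]


/-- Remark 1(c) of the paper: active bound constraints are preserved by quantization onto
the Cartesian grid. If `g` is a nearest grid point to `x ∈ L`, then every bound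
constraint active at `x` is also active at `g`. -/
theorem stmt_7 (n : ℕ) (hn : 1 ≤ n)
    (a b : EuclideanSpace ℝ (Fin n)) (hab : ∀ j, a j ≤ b j)
    (N : ℕ) (hN : 1 ≤ N)
    (L : Set (EuclideanSpace ℝ (Fin n)))
    (hL : L = {x | ∀ j, a j ≤ x j ∧ x j ≤ b j})
    (G : Set (EuclideanSpace ℝ (Fin n)))
    (hG : G = {g | ∀ j, ∃ z : ℕ, z ≤ N ∧ g j = a j + (b j - a j) * z / N})
    (x : EuclideanSpace ℝ (Fin n)) (hx : x ∈ L)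
    (g : EuclideanSpace ℝ (Fin n)) (hg : g ∈ G)
    (hnear : ∀ g' ∈ G, ‖x - g‖ ≤ ‖x - g'‖) :
    ∀ j, (x j = a j → g j = a j) ∧ (x j = b j → g j = b j) := by
  subst hG
  intro j
  have hcoord (z : ℕ) (hz : z ≤ N) (hxz : x j = a j + (b j - a j) * z / N) : g j = x j := by
    refine EuclideanSpace.eq_of_norm_sub_le_norm_sub_update (hnear _ fun i => ?_)
    rcases eq_or_ne i j with rfl | hij
    · exact ⟨z, hz, by simpa using hxz⟩
    · simpa [Function.update_of_ne hij] using hg i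
  have hN0 : (N : ℝ) ≠ 0 := by positivity
  exact ⟨fun h => (hcoord 0 N.zero_le (by simp [h])).trans h,
    fun h => (hcoord N le_rfl (by rw [h]; field_simp; ring)).trans h⟩
end
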